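/- arXiv:2510.12150 — 3 statements merged into one kernel-verified Lean document; each statement's English description precedes it below -/
import Mathlib

section
/- Let E be a real normed vector space, B ⊆ E a nonempty set, and δ, Δ real numbers such that ‖b − b'‖ ≤ δ for all b, b' ∈ B, and x ∈ E a point with Δ ≤ ‖x − b‖ for all b ∈ B. Then every point q of the convex hull convexHull ℝ B satisfies ‖x − q‖ ≥ Δ − δ. (A prompt key maintained inside the convex hull of one cluster stays at distance at least Δ − δ from every batch statistic of any other cluster.) -/
/-- A point far from every element of a set of small diameter
remains far from the convex hull of that set. -/
theorem dist_convexHull_ge_of_separated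
    {E : Type*} [NormedAddCommGroup E] [NormedSpace ℝ E]
    (B : Set E) (hB : B.Nonempty) (δ Δ : ℝ)
    (hdiam : ∀ b ∈ B, ∀ b' ∈ B, ‖b - b'‖ ≤ δ)
    (x : E) (hfar : ∀ b ∈ B, Δ ≤ ‖x - b‖) :
    ∀ q ∈ convexHull ℝ B, ‖x - q‖ ≥ Δ - δ := by
  intro q hq
  obtain ⟨b, hb⟩ := hB
  obtain ⟨b', hb', hqb⟩ := convexHull_exists_dist_ge hq b
  rw [dist_eq_norm, dist_eq_norm] at hqb
  linarith [norm_sub_le_norm_sub_add_norm_sub x q b, hfar b hb, hdiam b' hb' b hb]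
end

section
/- Let E be a real normed vector space and A, B ⊆ E nonempty sets. Suppose there are reals δ_A, δ_B, Δ with ‖a − a'‖ ≤ δ_A for all a, a' ∈ A, ‖b − b'‖ ≤ δ_B for all b, b' ∈ B, and Δ ≤ ‖a − b‖ for all a ∈ A, b ∈ B. Then for every p ∈ convexHull ℝ A and q ∈ convexHull ℝ B one has ‖p − q‖ ≥ Δ − δ_A − δ_B. (Prompt keys maintained in the convex hulls of two separated clusters remain separated.) -/
/-- A bound on the distances from `y` to the points of `s` extends to the convex hull of `s`. -/
lemma dist_le_of_mem_convexHull {E : Type*} [NormedAddCommGroup E] [NormedSpace ℝ E]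
    {s : Set E} {x y : E} {δ : ℝ} (hx : x ∈ convexHull ℝ s) (h : ∀ z ∈ s, dist z y ≤ δ) :
    dist x y ≤ δ := by
  obtain ⟨z, hz, hxz⟩ := convexHull_exists_dist_ge hx y
  exact hxz.trans (h z hz)

/-- Convex hulls of two separated sets of small diameters remain
quantitatively separated. -/
theorem convexHull_separation
    {E : Type*} [NormedAddCommGroup E] [NormedSpace ℝ E]
    (A B : Set E) (hA : A.Nonempty) (hB : B.Nonempty)
    (δA δB Δ : ℝ)
    (hdiamA : ∀ a ∈ A, ∀ a' ∈ A, ‖a - a'‖ ≤ δA)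
    (hdiamB : ∀ b ∈ B, ∀ b' ∈ B, ‖b - b'‖ ≤ δB)
    (hsep : ∀ a ∈ A, ∀ b ∈ B, Δ ≤ ‖a - b‖) :
    ∀ p ∈ convexHull ℝ A, ∀ q ∈ convexHull ℝ B, ‖p - q‖ ≥ Δ - δA - δB := by
  intro p hp q hq
  obtain ⟨a, ha⟩ := hA
  obtain ⟨b, hb⟩ := hB
  simp only [← dist_eq_norm] at *
  have hpa : dist p a ≤ δA := dist_le_of_mem_convexHull hp fun z hz => hdiamA z hz a ha
  have hqb : dist q b ≤ δB := dist_le_of_mem_convexHull hq fun z hz => hdiamB z hz b hb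
  linarith [hsep a ha b hb, dist_triangle4 a p q b, dist_comm a p]
end

section
/- Let E be a real normed vector space, I an index type, and C : I → Set E a (δ, Δ)-separated family of nonempty subsets. If p ∈ convexHull ℝ (C i), q ∈ convexHull ℝ (C j), and ‖p − q‖ < Δ − 2δ, then i = j. (Lemma 2: when the two fused prompts are sufficiently close, they necessarily represent the same cluster, so Knowledge Fusion only merges prompts from the same cluster.) -/
/-- If every point of `s` is within `r` of `a`, so is every point of its convex hull. -/
theorem norm_sub_le_of_mem_convexHull {E : Type*} [SeminormedAddCommGroup E] [NormedSpace ℝ E]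
    {s : Set E} {a x : E} {r : ℝ} (hs : ∀ y ∈ s, ‖y - a‖ ≤ r) (hx : x ∈ convexHull ℝ s) :
    ‖x - a‖ ≤ r :=
  mem_closedBall_iff_norm.1 <|
    convexHull_min (fun y hy => mem_closedBall_iff_norm.2 (hs y hy)) (convex_closedBall a r) hx

/-- Lemma 2: For a (δ, Δ)-separated family of nonempty clusters,
two points of the convex hulls of clusters `i` and `j` that are closer
than Δ - 2δ must come from the same cluster. -/
theorem close_hull_points_same_cluster
    {E : Type*} [NormedAddCommGroup E] [NormedSpace ℝ E]
    {I : Type*} (C : I → Set E) (δ Δ : ℝ)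
    (hδ : 0 ≤ δ) (hΔ : 0 < Δ)
    (hne : ∀ i, (C i).Nonempty)
    (hintra : ∀ i, ∀ a ∈ C i, ∀ a' ∈ C i, ‖a - a'‖ ≤ δ)
    (hinter : ∀ i j, i ≠ j → ∀ a ∈ C i, ∀ b ∈ C j, Δ ≤ ‖a - b‖)
    {i j : I} {p q : E}
    (hp : p ∈ convexHull ℝ (C i)) (hq : q ∈ convexHull ℝ (C j))
    (hclose : ‖p - q‖ < Δ - 2 * δ) : i = j := by
  by_contra hij
  obtain ⟨a, ha⟩ := hne i
  obtain ⟨b, hb⟩ := hne j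
  have hpa : ‖p - a‖ ≤ δ := norm_sub_le_of_mem_convexHull (fun y hy => hintra i y hy a ha) hp
  have hqb : ‖q - b‖ ≤ δ := norm_sub_le_of_mem_convexHull (fun y hy => hintra j y hy b hb) hq
  have hab : Δ ≤ ‖a - b‖ := hinter i j hij a ha b hb
  have hap : ‖a - b‖ ≤ ‖a - p‖ + ‖p - b‖ := norm_sub_le_norm_sub_add_norm_sub a p b
  have hpb : ‖p - b‖ ≤ ‖p - q‖ + ‖q - b‖ := norm_sub_le_norm_sub_add_norm_sub p q b
  rw [norm_sub_rev a p] at hap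
  linarith
end
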